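/- arXiv:1605.01267 — 2 statements merged into one kernel-verified Lean document; each statement's English description precedes it below -/
import Mathlib

section
/- For all vectors x, y, z, w in ℝ⁸ one has Φ₀(x,y,z,w)² + ‖τ(x,y,z,w)‖² = |x∧y∧z∧w|², where ‖·‖ is the norm of 2-forms on ℝ⁸ (Harvey–Lawson's identity for the Cayley calibration). -/
noncomputable section
open scoped RealInnerProductSpace

abbrev E8 := EuclideanSpace ℝ (Fin 8)

/-- `dxⁱ ∧ dxʲ ∧ dxᵏ ∧ dxˡ` evaluated on `(x, y, z, w)` (indices 0-based). -/
def d4 (i j k l : Fin 8) (x y z w : E8) : ℝ :=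
  Matrix.det !![x i, x j, x k, x l; y i, y j, y k, y l;
                z i, z j, z k, z l; w i, w j, w k, w l]

/-- The Cayley 4-form
`Φ₀ = dx¹²³⁴ + dx¹²⁵⁶ − dx¹²⁷⁸ + dx¹³⁵⁷ + dx¹³⁶⁸ + dx¹⁴⁵⁸ − dx¹⁴⁶⁷ − dx²³⁵⁸ + dx²³⁶⁷`
`  + dx²⁴⁵⁷ + dx²⁴⁶⁸ − dx³⁴⁵⁶ + dx³⁴⁷⁸ + dx⁵⁶⁷⁸` (1-based indices; here 0-based). -/
def Phi (x y z w : E8) : ℝ :=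
  d4 0 1 2 3 x y z w + d4 0 1 4 5 x y z w - d4 0 1 6 7 x y z w
    + d4 0 2 4 6 x y z w + d4 0 2 5 7 x y z w + d4 0 3 4 7 x y z w
    - d4 0 3 5 6 x y z w - d4 1 2 4 7 x y z w + d4 1 2 5 6 x y z w
    + d4 1 3 4 6 x y z w + d4 1 3 5 7 x y z w - d4 2 3 4 5 x y z w
    + d4 2 3 6 7 x y z w + d4 4 5 6 7 x y z w

/-- The Gram determinant `|x∧y∧z∧w|² = det(⟨vᵢ,vⱼ⟩)`. -/
def gram4 (x y z w : E8) : ℝ :=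
  Matrix.det !![⟪x, x⟫, ⟪x, y⟫, ⟪x, z⟫, ⟪x, w⟫;
                ⟪y, x⟫, ⟪y, y⟫, ⟪y, z⟫, ⟪y, w⟫;
                ⟪z, x⟫, ⟪z, y⟫, ⟪z, z⟫, ⟪z, w⟫;
                ⟪w, x⟫, ⟪w, y⟫, ⟪w, z⟫, ⟪w, w⟫]

/-- The standard orthonormal basis vector `eᵢ` of ℝ⁸. -/
def e₈ (i : Fin 8) : E8 := EuclideanSpace.single i 1

/-- `α : ℝ⁸ × ℝ⁸ → ℝ` is a 2-form: antisymmetric and bilinear. -/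
def IsForm2 (α : E8 → E8 → ℝ) : Prop :=
  (∀ a b, α b a = -α a b) ∧
  (∀ a a' b, α (a + a') b = α a b + α a' b) ∧
  (∀ (r : ℝ) a b, α (r • a) b = r * α a b)

/-- The inner product of 2-forms: `⟨α,β⟩ = Σ_{i<j} α(eᵢ,eⱼ) β(eᵢ,eⱼ)`. -/
def innerF2 (α β : E8 → E8 → ℝ) : ℝ :=
  ∑ i : Fin 8, ∑ j : Fin 8, if i < j then α (e₈ i) (e₈ j) * β (e₈ i) (e₈ j) else 0

/-- The volume form `vol = dx¹∧⋯∧dx⁸` evaluated on eight vectors. -/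
def vol8 (x : Fin 8 → E8) : ℝ :=
  Matrix.det (Matrix.of fun i j : Fin 8 => x i j)

/-- The 6-form `v♭ ∧ w♭ ∧ Φ₀` evaluated on six vectors
(`v♭ = ⟨v,·⟩`; the wedge of a 2-form with a 4-form via the shuffle/permutation formula). -/
def sixForm (v w : E8) (x : Fin 6 → E8) : ℝ :=
  (1 / 48 : ℝ) * ∑ σ : Equiv.Perm (Fin 6), ((Equiv.Perm.sign σ : ℤ) : ℝ) *
    ((⟪v, x (σ 0)⟫ * ⟪w, x (σ 1)⟫ - ⟪v, x (σ 1)⟫ * ⟪w, x (σ 0)⟫) *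
      Phi (x (σ 2)) (x (σ 3)) (x (σ 4)) (x (σ 5)))

/-- The 8-form `α ∧ β` for a 2-form `α` and a 6-form `β`, evaluated on eight vectors
(via the permutation formula, with the factor `1/(2!·6!) = 1/1440`). -/
def wedge26 (α : E8 → E8 → ℝ) (β : (Fin 6 → E8) → ℝ) (x : Fin 8 → E8) : ℝ :=
  (1 / 1440 : ℝ) * ∑ σ : Equiv.Perm (Fin 8), ((Equiv.Perm.sign σ : ℤ) : ℝ) *
    (α (x (σ 0)) (x (σ 1)) * β fun i : Fin 6 => x (σ ⟨i.1 + 2, by omega⟩))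

def mm (x y : E8) (i j : Fin 8) : ℝ := x i * y j - x j * y i

lemma d4_eq (i j k l : Fin 8) (x y z w : E8) : d4 i j k l x y z w =
    mm x y i j * mm z w k l - mm x y i k * mm z w j l + mm x y i l * mm z w j k
    + mm x y j k * mm z w i l - mm x y j l * mm z w i k + mm x y k l * mm z w i j := by
  simp only [d4, mm, Matrix.det_succ_row_zero, Fin.sum_univ_succ]
  simp [Fin.succAbove]
  ring

lemma inner_eq (x y : E8) : ⟪x, y⟫ = x 0 * y 0 + x 1 * y 1 + x 2 * y 2 + x 3 * y 3
    + x 4 * y 4 + x 5 * y 5 + x 6 * y 6 + x 7 * y 7 := by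
  simp [PiLp.inner_apply, Fin.sum_univ_eight]; ring

lemma e₈_apply (i j : Fin 8) : e₈ i j = if j = i then 1 else 0 := by
  simp [e₈]

/-- Alternating sum over `S₈`. -/
def altSum (g : Equiv.Perm (Fin 8) → ℝ) : ℝ :=
  ∑ σ : Equiv.Perm (Fin 8), ((Equiv.Perm.sign σ : ℤ) : ℝ) * g σ

lemma altSum_mul (g : Equiv.Perm (Fin 8) → ℝ) (ρ : Equiv.Perm (Fin 8)) :
    altSum (fun σ => g (σ * ρ)) = ((Equiv.Perm.sign ρ : ℤ) : ℝ) * altSum g := by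
  unfold altSum
  rw [← Equiv.sum_comp (Equiv.mulRight ρ) (fun σ => ((Equiv.Perm.sign σ : ℤ) : ℝ) * g σ),
    Finset.mul_sum]
  refine Finset.sum_congr rfl fun σ _ => ?_
  have h : ((Equiv.Perm.sign ρ : ℤ) : ℝ) * ((Equiv.Perm.sign ρ : ℤ) : ℝ) = 1 := by
    rcases Int.units_eq_one_or (Equiv.Perm.sign ρ) with h | h <;> simp [h]
  simp only [Equiv.coe_mulRight, Equiv.Perm.sign_mul, Units.val_mul, Int.cast_mul]
  linear_combination (-((Equiv.Perm.sign σ : ℤ) : ℝ) * g (σ * ρ)) * h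

/-- Extend a permutation of the last `n` indices. -/
def ext26 (τ : Equiv.Perm (Fin 6)) : Equiv.Perm (Fin 8) :=
  (finSumFinEquiv (m := 2) (n := 6)).permCongr (Equiv.Perm.sumCongr 1 τ)

def ext44 (τ : Equiv.Perm (Fin 4)) : Equiv.Perm (Fin 8) :=
  (finSumFinEquiv (m := 4) (n := 4)).permCongr (Equiv.Perm.sumCongr 1 τ)

lemma sign_ext26 (τ : Equiv.Perm (Fin 6)) : Equiv.Perm.sign (ext26 τ) = Equiv.Perm.sign τ := by
  simp [ext26]

lemma sign_ext44 (τ : Equiv.Perm (Fin 4)) : Equiv.Perm.sign (ext44 τ) = Equiv.Perm.sign τ := by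
  simp [ext44]

lemma ext26_low (τ : Equiv.Perm (Fin 6)) (i : Fin 2) :
    ext26 τ (Fin.castAdd 6 i) = Fin.castAdd 6 i := by
  change finSumFinEquiv (m := 2) (n := 6) (Sum.map id τ
    ((finSumFinEquiv (m := 2) (n := 6)).symm (finSumFinEquiv (Sum.inl i)))) = _
  rw [Equiv.symm_apply_apply]
  rfl

lemma ext26_high (τ : Equiv.Perm (Fin 6)) (i : Fin 6) :
    ext26 τ (Fin.natAdd 2 i) = Fin.natAdd 2 (τ i) := by
  change finSumFinEquiv (m := 2) (n := 6) (Sum.map id τ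
    ((finSumFinEquiv (m := 2) (n := 6)).symm (finSumFinEquiv (Sum.inr i)))) = _
  rw [Equiv.symm_apply_apply]
  rfl

lemma ext44_low (τ : Equiv.Perm (Fin 4)) (i : Fin 4) :
    ext44 τ (Fin.castAdd 4 i) = Fin.castAdd 4 i := by
  change finSumFinEquiv (m := 4) (n := 4) (Sum.map id τ
    ((finSumFinEquiv (m := 4) (n := 4)).symm (finSumFinEquiv (Sum.inl i)))) = _
  rw [Equiv.symm_apply_apply]
  rfl

lemma ext44_high (τ : Equiv.Perm (Fin 4)) (i : Fin 4) :
    ext44 τ (Fin.natAdd 4 i) = Fin.natAdd 4 (τ i) := by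
  change finSumFinEquiv (m := 4) (n := 4) (Sum.map id τ
    ((finSumFinEquiv (m := 4) (n := 4)).symm (finSumFinEquiv (Sum.inr i)))) = _
  rw [Equiv.symm_apply_apply]
  rfl

lemma sign_sq {n : ℕ} (τ : Equiv.Perm (Fin n)) :
    ((Equiv.Perm.sign τ : ℤ) : ℝ) * ((Equiv.Perm.sign τ : ℤ) : ℝ) = 1 := by
  rcases Int.units_eq_one_or (Equiv.Perm.sign τ) with h | h <;> simp [h]

/-- The iterated wedge as a single alternating sum. -/
lemma wedge_eq (α : E8 → E8 → ℝ) (v w : E8) (x : Fin 8 → E8) :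
    wedge26 α (sixForm v w) x = (1 / 96 : ℝ) * altSum (fun σ =>
      α (x (σ 0)) (x (σ 1)) * ((⟪v, x (σ 2)⟫ * ⟪w, x (σ 3)⟫ - ⟪v, x (σ 3)⟫ * ⟪w, x (σ 2)⟫) *
        Phi (x (σ 4)) (x (σ 5)) (x (σ 6)) (x (σ 7)))) := by
  set F : Equiv.Perm (Fin 8) → ℝ := fun σ =>
      α (x (σ 0)) (x (σ 1)) * ((⟪v, x (σ 2)⟫ * ⟪w, x (σ 3)⟫ - ⟪v, x (σ 3)⟫ * ⟪w, x (σ 2)⟫) *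
        Phi (x (σ 4)) (x (σ 5)) (x (σ 6)) (x (σ 7))) with hF
  have key : ∀ (σ : Equiv.Perm (Fin 8)) (τ : Equiv.Perm (Fin 6)), F (σ * ext26 τ) =
      α (x (σ 0)) (x (σ 1)) *
      ((⟪v, x (σ (Fin.natAdd 2 (τ 0)))⟫ * ⟪w, x (σ (Fin.natAdd 2 (τ 1)))⟫
        - ⟪v, x (σ (Fin.natAdd 2 (τ 1)))⟫ * ⟪w, x (σ (Fin.natAdd 2 (τ 0)))⟫) *
      Phi (x (σ (Fin.natAdd 2 (τ 2)))) (x (σ (Fin.natAdd 2 (τ 3))))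
        (x (σ (Fin.natAdd 2 (τ 4)))) (x (σ (Fin.natAdd 2 (τ 5))))) := by
    intro σ τ
    have h0 : ext26 τ 0 = 0 := ext26_low τ 0
    have h1 : ext26 τ 1 = 1 := ext26_low τ 1
    have h2 : ext26 τ 2 = _ := ext26_high τ 0
    have h3 : ext26 τ 3 = _ := ext26_high τ 1
    have h4 : ext26 τ 4 = _ := ext26_high τ 2
    have h5 : ext26 τ 5 = _ := ext26_high τ 3
    have h6 : ext26 τ 6 = _ := ext26_high τ 4
    have h7 : ext26 τ 7 = _ := ext26_high τ 5
    simp only [hF, Equiv.Perm.mul_apply, h0, h1, h2, h3, h4, h5, h6, h7]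
  have hidx : ∀ i : Fin 6, (⟨i.1 + 2, by omega⟩ : Fin 8) = Fin.natAdd 2 i := by
    intro i; ext; simp [add_comm]
  have e1 : wedge26 α (sixForm v w) x = (1 / 1440 : ℝ) * ((1 / 48 : ℝ) *
      ∑ τ : Equiv.Perm (Fin 6), ((Equiv.Perm.sign τ : ℤ) : ℝ) *
        altSum (fun σ => F (σ * ext26 τ))) := by
    simp only [wedge26, sixForm, altSum, key, hidx, Finset.mul_sum]
    rw [Finset.sum_comm]
    refine Finset.sum_congr rfl fun τ _ => Finset.sum_congr rfl fun σ _ => ?_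
    ring
  rw [e1]
  simp only [altSum_mul, sign_ext26, ← mul_assoc, sign_sq, one_mul]
  simp [Fintype.card_perm, Nat.factorial]
  ring

lemma altSum_smul (c : ℝ) (g : Equiv.Perm (Fin 8) → ℝ) :
    altSum (fun σ => c * g σ) = c * altSum g := by
  simp only [altSum, Finset.mul_sum]
  exact Finset.sum_congr rfl fun _ _ => by ring

lemma altSum_add (f g : Equiv.Perm (Fin 8) → ℝ) :
    altSum (fun σ => f σ + g σ) = altSum f + altSum g := by
  simp only [altSum, mul_add, Finset.sum_add_distrib]

lemma altSum_sub (f g : Equiv.Perm (Fin 8) → ℝ) :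
    altSum (fun σ => f σ - g σ) = altSum f - altSum g := by
  simp only [altSum, mul_sub, Finset.sum_sub_distrib]

lemma altSum_sum {ι : Type*} (s : Finset ι) (f : ι → Equiv.Perm (Fin 8) → ℝ) :
    altSum (fun σ => ∑ i ∈ s, f i σ) = ∑ i ∈ s, altSum (f i) := by
  simp only [altSum, Finset.mul_sum]
  rw [Finset.sum_comm]

lemma altSum_swap (f : Equiv.Perm (Fin 8) → ℝ) (a b : Fin 8) (hab : a ≠ b) :
    altSum (fun σ => f σ - f (σ * Equiv.swap a b)) = 2 * altSum f := by
  rw [altSum_sub, altSum_mul, Equiv.Perm.sign_swap hab]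
  simp; ring

/-- Eight dimensional Levi-Civita symbol. -/
def eps (f : Fin 8 → Fin 8) : ℤ :=
  ∏ j, ∏ i ∈ Finset.Iio j, if f i < f j then 1 else if f j < f i then -1 else 0

lemma altSum_eps (f : Fin 8 → Fin 8) :
    altSum (fun σ => if ⇑σ = f then 1 else 0) = eps f := by
  by_cases hf : Function.Injective f
  · obtain ⟨ρ, hρ⟩ : ∃ ρ : Equiv.Perm (Fin 8), ⇑ρ = f :=
      ⟨Equiv.ofBijective f (Finite.injective_iff_bijective.mp hf), rfl⟩
    subst hρ
    simp only [altSum, DFunLike.coe_fn_eq, mul_ite, mul_one, mul_zero, Finset.sum_ite_eq',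
      Finset.mem_univ, if_true]
    congr 1
    rw [Equiv.Perm.sign_eq_prod_prod_Iio, eps]
    push_cast
    refine Finset.prod_congr rfl fun j _ => Finset.prod_congr rfl fun i hi => ?_
    have hij : i ≠ j := (Finset.mem_Iio.mp hi).ne
    have hne : ρ i ≠ ρ j := fun h => hij (ρ.injective h)
    rcases lt_or_gt_of_ne hne with h | h
    · simp [h]
    · simp [h, not_lt.mpr h.le]
  · have h1 : eps f = 0 := by
      simp only [Function.Injective, not_forall] at hf
      obtain ⟨a, b, hab, hne⟩ := hf
      wlog hlt : a < b generalizing a b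
      · exact this b a hab.symm (Ne.symm hne) (lt_of_le_of_ne (not_lt.mp hlt) (Ne.symm hne))
      exact Finset.prod_eq_zero (Finset.mem_univ b)
        (Finset.prod_eq_zero (Finset.mem_Iio.mpr hlt) (by simp [hab]))
    rw [h1]
    simp only [altSum, Int.cast_zero]
    refine Finset.sum_eq_zero fun σ _ => ?_
    rw [if_neg, mul_zero]
    rintro rfl
    exact hf σ.injective

lemma altSum_d4 (p q : Fin 8) (v w : E8) (i j k l : Fin 8) :
    altSum (fun σ => (e₈ (σ 0) p * e₈ (σ 1) q - e₈ (σ 0) q * e₈ (σ 1) p) *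
      ((v (σ 2) * w (σ 3) - v (σ 3) * w (σ 2)) *
        d4 i j k l (e₈ (σ 4)) (e₈ (σ 5)) (e₈ (σ 6)) (e₈ (σ 7)))) =
    96 * ∑ r, ∑ s, v r * w s * (eps ![p, q, r, s, i, j, k, l] : ℝ) := by
  set A : Equiv.Perm (Fin 8) → ℝ := fun σ => e₈ (σ 0) p * e₈ (σ 1) q with hA
  set B : Equiv.Perm (Fin 8) → ℝ := fun σ => v (σ 2) * w (σ 3) with hB
  set D : Equiv.Perm (Fin 8) → ℝ := fun σ =>
    e₈ (σ 4) i * e₈ (σ 5) j * e₈ (σ 6) k * e₈ (σ 7) l with hD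
  set DD : Equiv.Perm (Fin 8) → ℝ := fun σ =>
    d4 i j k l (e₈ (σ 4)) (e₈ (σ 5)) (e₈ (σ 6)) (e₈ (σ 7)) with hDD
  have hDD2 : ∀ σ, DD σ = ∑ τ : Equiv.Perm (Fin 4), ((Equiv.Perm.sign τ : ℤ) : ℝ) *
      D (σ * ext44 τ) := by
    intro σ
    have h4 : ∀ τ, ext44 τ 4 = _ := fun τ => ext44_high τ 0
    have h5 : ∀ τ, ext44 τ 5 = _ := fun τ => ext44_high τ 1
    have h6 : ∀ τ, ext44 τ 6 = _ := fun τ => ext44_high τ 2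
    have h7 : ∀ τ, ext44 τ 7 = _ := fun τ => ext44_high τ 3
    simp only [hDD, hD, d4, Equiv.Perm.mul_apply, h4, h5, h6, h7]
    have hM : (!![e₈ (σ 4) i, e₈ (σ 4) j, e₈ (σ 4) k, e₈ (σ 4) l;
        e₈ (σ 5) i, e₈ (σ 5) j, e₈ (σ 5) k, e₈ (σ 5) l;
        e₈ (σ 6) i, e₈ (σ 6) j, e₈ (σ 6) k, e₈ (σ 6) l;
        e₈ (σ 7) i, e₈ (σ 7) j, e₈ (σ 7) k, e₈ (σ 7) l] : Matrix (Fin 4) (Fin 4) ℝ) =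
        Matrix.of (fun a b : Fin 4 => e₈ (σ (Fin.natAdd 4 a)) (![i, j, k, l] b)) := by
      ext a b; fin_cases a <;> fin_cases b <;> rfl
    rw [hM, Matrix.det_apply']
    simp [Fin.prod_univ_four]
  have s01 : ∀ σ, (e₈ (σ 0) p * e₈ (σ 1) q - e₈ (σ 0) q * e₈ (σ 1) p) *
      ((v (σ 2) * w (σ 3) - v (σ 3) * w (σ 2)) * DD σ) =
      (fun σ => A σ * (v (σ 2) * w (σ 3) - v (σ 3) * w (σ 2)) * DD σ) σ
      - (fun σ => A σ * (v (σ 2) * w (σ 3) - v (σ 3) * w (σ 2)) * DD σ)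
        (σ * Equiv.swap 0 1) := by
    intro σ
    simp [hA, hDD, Equiv.swap_apply_of_ne_of_ne]
    ring
  have s23 : ∀ σ, A σ * (v (σ 2) * w (σ 3) - v (σ 3) * w (σ 2)) * DD σ =
      (fun σ => A σ * B σ * DD σ) σ - (fun σ => A σ * B σ * DD σ) (σ * Equiv.swap 2 3) := by
    intro σ
    simp [hA, hB, hDD, Equiv.swap_apply_of_ne_of_ne]
    ring
  have s4 : ∀ σ, A σ * B σ * DD σ = ∑ τ : Equiv.Perm (Fin 4), ((Equiv.Perm.sign τ : ℤ) : ℝ) *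
      (fun σ => A σ * B σ * D σ) (σ * ext44 τ) := by
    intro σ
    have h0 : ∀ τ, ext44 τ 0 = 0 := fun τ => ext44_low τ 0
    have h1 : ∀ τ, ext44 τ 1 = 1 := fun τ => ext44_low τ 1
    have h2 : ∀ τ, ext44 τ 2 = 2 := fun τ => ext44_low τ 2
    have h3 : ∀ τ, ext44 τ 3 = 3 := fun τ => ext44_low τ 3
    rw [hDD2, Finset.mul_sum]
    refine Finset.sum_congr rfl fun τ _ => ?_
    simp only [hA, hB, Equiv.Perm.mul_apply, h0, h1, h2, h3]
    ring
  have s5 : altSum (fun σ => A σ * B σ * D σ) =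
      ∑ r, ∑ s, v r * w s * (eps ![p, q, r, s, i, j, k, l] : ℝ) := by
    simp only [← altSum_eps, ← altSum_smul, ← altSum_sum]
    congr 1
    funext σ
    rw [Finset.sum_eq_single (σ 2), Finset.sum_eq_single (σ 3)]
    · have hiff : (⇑σ = ![p, q, σ 2, σ 3, i, j, k, l]) ↔
          (p = σ 0 ∧ q = σ 1 ∧ i = σ 4 ∧ j = σ 5 ∧ k = σ 6 ∧ l = σ 7) := by
        rw [funext_iff]
        simp [Fin.forall_fin_succ, eq_comm]
      simp only [hA, hB, hD, e₈_apply, hiff]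
      by_cases c0 : p = σ 0 <;> by_cases c1 : q = σ 1 <;> by_cases c4 : i = σ 4 <;>
        by_cases c5 : j = σ 5 <;> by_cases c6 : k = σ 6 <;> by_cases c7 : l = σ 7 <;>
        simp [c0, c1, c4, c5, c6, c7]
    · intro s _ hs
      rw [if_neg, mul_zero]
      intro h
      exact hs (by rw [h]; rfl)
    · simp
    · intro r _ hr
      refine Finset.sum_eq_zero fun s _ => ?_
      rw [if_neg, mul_zero]
      intro h
      exact hr (by rw [h]; rfl)
    · simp
  refine (congrArg altSum (funext s01)).trans ?_
  rw [altSum_swap _ _ _ (by decide)]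
  rw [congrArg altSum (funext s23)]
  rw [altSum_swap _ _ _ (by decide)]
  have s6 : altSum (fun σ => A σ * B σ * DD σ) = 24 * altSum (fun σ => A σ * B σ * D σ) := by
    rw [congrArg altSum (funext s4), altSum_sum]
    have : ∀ τ : Equiv.Perm (Fin 4), altSum (fun σ => ((Equiv.Perm.sign τ : ℤ) : ℝ) *
        (fun σ => A σ * B σ * D σ) (σ * ext44 τ)) = altSum (fun σ => A σ * B σ * D σ) := by
      intro τ
      rw [altSum_smul, altSum_mul (fun σ => A σ * B σ * D σ), sign_ext44, ← mul_assoc, sign_sq,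
        one_mul]
    rw [Finset.sum_congr rfl fun τ _ => this τ]
    simp [Fintype.card_perm, Nat.factorial]
  rw [s6, s5]
  ring

/-- The signed sum over the fourteen terms of the Cayley form. -/
def comb {R : Type*} [Ring R] (D : Fin 8 → Fin 8 → Fin 8 → Fin 8 → R) : R :=
  D 0 1 2 3 + D 0 1 4 5 - D 0 1 6 7 + D 0 2 4 6 + D 0 2 5 7 + D 0 3 4 7
    - D 0 3 5 6 - D 1 2 4 7 + D 1 2 5 6 + D 1 3 4 6 + D 1 3 5 7 - D 2 3 4 5
    + D 2 3 6 7 + D 4 5 6 7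

lemma Phi_comb (x y z w : E8) : Phi x y z w = comb (fun i j k l => d4 i j k l x y z w) := rfl

lemma comb_cast (D : Fin 8 → Fin 8 → Fin 8 → Fin 8 → ℤ) :
    ((comb D : ℤ) : ℝ) = comb (fun i j k l => (D i j k l : ℝ)) := by
  simp [comb]

lemma comb_mul (c : ℝ) (D : Fin 8 → Fin 8 → Fin 8 → Fin 8 → ℝ) :
    c * comb D = comb (fun i j k l => c * D i j k l) := by
  simp only [comb]; ring

lemma comb_sum {ι : Type*} (s : Finset ι) (D : ι → Fin 8 → Fin 8 → Fin 8 → Fin 8 → ℝ) :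
    ∑ r ∈ s, comb (D r) = comb (fun i j k l => ∑ r ∈ s, D r i j k l) := by
  simp only [comb, Finset.sum_add_distrib, Finset.sum_sub_distrib]

lemma comb_altSum (D : Fin 8 → Fin 8 → Fin 8 → Fin 8 → Equiv.Perm (Fin 8) → ℝ) :
    altSum (fun σ => comb (fun i j k l => D i j k l σ)) =
      comb (fun i j k l => altSum (D i j k l)) := by
  simp only [comb, altSum_add, altSum_sub]

/-- `comb` over the integers, with natural number indices, for fast evaluation. -/
def combN (D : ℕ → ℕ → ℕ → ℕ → ℤ) : ℤ :=
  Int.add (D 0 1 2 3) (Int.add (D 0 1 4 5) (Int.add (Int.neg (D 0 1 6 7)) (Int.add (D 0 2 4 6)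
  (Int.add (D 0 2 5 7) (Int.add (D 0 3 4 7) (Int.add (Int.neg (D 0 3 5 6))
  (Int.add (Int.neg (D 1 2 4 7)) (Int.add (D 1 2 5 6) (Int.add (D 1 3 4 6) (Int.add (D 1 3 5 7)
  (Int.add (Int.neg (D 2 3 4 5)) (Int.add (D 2 3 6 7) (D 4 5 6 7)))))))))))))

lemma combN_eq (D : ℕ → ℕ → ℕ → ℕ → ℤ) :
    combN D = comb (fun i j k l : Fin 8 => D i j k l) := by
  have ha : ∀ a b : ℤ, Int.add a b = a + b := fun _ _ => rfl
  have hn : ∀ a : ℤ, Int.neg a = -a := fun _ => rfl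
  simp only [combN, comb, ha, hn]
  change D 0 1 2 3 + (D 0 1 4 5 + (-(D 0 1 6 7) + (D 0 2 4 6 + (D 0 2 5 7 + (D 0 3 4 7
    + (-(D 0 3 5 6) + (-(D 1 2 4 7) + (D 1 2 5 6 + (D 1 3 4 6 + (D 1 3 5 7
    + (-(D 2 3 4 5) + (D 2 3 6 7 + D 4 5 6 7)))))))))))) =
    D 0 1 2 3 + D 0 1 4 5 - D 0 1 6 7 + D 0 2 4 6 + D 0 2 5 7 + D 0 3 4 7
    - D 0 3 5 6 - D 1 2 4 7 + D 1 2 5 6 + D 1 3 4 6 + D 1 3 5 7 - D 2 3 4 5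
    + D 2 3 6 7 + D 4 5 6 7
  ring

def rowN (a : ℕ) : List ℕ → ℤ → ℤ
  | [], t => t
  | b :: l, t => bif Nat.blt a b then rowN a l t else
      bif Nat.blt b a then rowN a l (Int.neg t) else 0

def epsN : List ℕ → ℤ → ℤ
  | [], t => t
  | a :: l, t => match rowN a l t with
    | Int.ofNat 0 => 0
    | s => epsN l s

/-- sign of `b - a`. -/
def sgN (a b : ℕ) : ℤ := if a < b then 1 else if b < a then -1 else 0

lemma rowN_cons (a b : ℕ) (l : List ℕ) (t : ℤ) :
    rowN a (b :: l) t = rowN a l (sgN a b * t) := by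
  have h0 : ∀ l, rowN a l 0 = 0 := by
    intro l
    induction l with
    | nil => rfl
    | cons c l ih =>
      simp only [rowN, show Int.neg 0 = 0 from rfl, ih]
      cases Nat.blt a c <;> cases Nat.blt c a <;> rfl
  have hn : ∀ a : ℤ, Int.neg a = -a := fun _ => rfl
  have hb : ∀ a b : ℕ, Nat.blt a b = decide (a < b) := by
    intro a b
    rw [Bool.eq_iff_iff, Nat.blt_eq, decide_eq_true_eq]
  simp only [rowN, sgN, hn, hb]
  rcases lt_trichotomy a b with h | h | h
  · simp [h]
  · subst h; simp [h0]
  · simp [h, not_lt.mpr h.le]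

lemma epsN_zero : ∀ l, epsN l 0 = 0
  | [] => rfl
  | a :: l => by
    have h0 : ∀ l, rowN a l 0 = 0 := by
      intro l
      induction l with
      | nil => rfl
      | cons c l ih => rw [rowN_cons, mul_zero, ih]
    simp only [epsN, h0]
    rfl

lemma epsN_cons (a : ℕ) (l : List ℕ) (t : ℤ) : epsN (a :: l) t = epsN l (rowN a l t) := by
  rw [epsN]
  split
  · next h => rw [h]; exact (epsN_zero l).symm
  · rfl

lemma epsN_eq (p q r s i j k l : Fin 8) :
    eps ![p, q, r, s, i, j, k, l] = epsN [p, q, r, s, i, j, k, l] 1 := by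
  have hs : ∀ a b : Fin 8, (if a < b then (1 : ℤ) else if b < a then -1 else 0) =
      sgN a b := fun a b => rfl
  have i0 : Finset.Iio (0 : Fin 8) = ∅ := by decide
  have i1 : Finset.Iio (1 : Fin 8) = {0} := by decide
  have i2 : Finset.Iio (2 : Fin 8) = {0, 1} := by decide
  have i3 : Finset.Iio (3 : Fin 8) = {0, 1, 2} := by decide
  have i4 : Finset.Iio (4 : Fin 8) = {0, 1, 2, 3} := by decide
  have i5 : Finset.Iio (5 : Fin 8) = {0, 1, 2, 3, 4} := by decide
  have i6 : Finset.Iio (6 : Fin 8) = {0, 1, 2, 3, 4, 5} := by decide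
  have i7 : Finset.Iio (7 : Fin 8) = {0, 1, 2, 3, 4, 5, 6} := by decide
  simp only [epsN_cons, rowN_cons]
  simp only [epsN, rowN, eps, hs, Fin.prod_univ_eight, i0, i1, i2, i3, i4, i5, i6, i7]
  simp
  ring

/-- Integer version of `mm` on basis vectors. -/
def mmN (a b i j : ℕ) : ℤ :=
  bif Nat.beq i a then (bif Nat.beq j b then (bif Nat.beq i j then 0 else 1) else 0)
  else bif Nat.beq j a then (bif Nat.beq i b then -1 else 0) else 0

def mulN (a : ℤ) (b : Unit → ℤ) : ℤ :=
  match a with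
  | Int.ofNat 0 => 0
  | s => Int.mul s (b ())

lemma mulN_eq (a : ℤ) (b : Unit → ℤ) : mulN a b = a * b () := by
  unfold mulN
  split
  · simp
  · rfl

def d4N (a b c d i j k l : ℕ) : ℤ :=
  Int.add (mulN (mmN a b i j) fun _ => mmN c d k l)
  (Int.add (Int.neg (mulN (mmN a b i k) fun _ => mmN c d j l))
  (Int.add (mulN (mmN a b i l) fun _ => mmN c d j k)
  (Int.add (mulN (mmN a b j k) fun _ => mmN c d i l)
  (Int.add (Int.neg (mulN (mmN a b j l) fun _ => mmN c d i k))
  (mulN (mmN a b k l) fun _ => mmN c d i j)))))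

def check4 (p q r s : ℕ) : Bool :=
  decide (combN (fun i j k l => epsN [p, q, r, s, i, j, k, l] 1) = combN (d4N r s p q))

def checkAll : Bool :=
  [0, 1, 2, 3, 4, 5, 6, 7].all fun p => [0, 1, 2, 3, 4, 5, 6, 7].all fun q =>
    bif Nat.blt p q then
      [0, 1, 2, 3, 4, 5, 6, 7].all fun r => [0, 1, 2, 3, 4, 5, 6, 7].all fun s =>
        check4 p q r s
    else true

lemma checkAll_true : checkAll = true := by
  decide +kernel

lemma eps_table (p q r s : Fin 8) (hpq : p < q) :
    comb (fun i j k l => eps ![p, q, r, s, i, j, k, l]) =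
      comb (fun i j k l : Fin 8 => d4N r s p q i j k l) := by
  have hm : ∀ a : Fin 8, (a : ℕ) ∈ [0, 1, 2, 3, 4, 5, 6, 7] := by decide
  have h := checkAll_true
  simp only [checkAll, List.all_eq_true] at h
  have h1 := h p (hm p) q (hm q)
  have hb : Nat.blt p q = true := by simpa [Nat.blt_eq] using hpq
  simp only [hb, cond_true, List.all_eq_true] at h1
  have h2 := h1 r (hm r) s (hm s)
  simp only [check4, decide_eq_true_eq] at h2
  simp only [epsN_eq]
  rw [← combN_eq (fun i j k l => epsN [p, q, r, s, i, j, k, l] 1), h2, combN_eq]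

lemma mmN_cast (a b i j : Fin 8) : mm (e₈ a) (e₈ b) i j = (mmN a b i j : ℝ) := by
  have hb : ∀ x y : Fin 8, Nat.beq x y = decide (x = y) := by decide
  simp only [mm, e₈_apply, mmN, hb]
  by_cases h1 : i = a <;> by_cases h2 : j = b <;> by_cases h3 : j = a <;>
    by_cases h4 : i = b <;> by_cases h5 : i = j <;> simp_all

lemma d4Z_cast (i j k l a b c d : Fin 8) :
    d4 i j k l (e₈ a) (e₈ b) (e₈ c) (e₈ d) = (d4N a b c d i j k l : ℝ) := by
  have ha : ∀ a b : ℤ, Int.add a b = a + b := fun _ _ => rfl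
  have hn : ∀ a : ℤ, Int.neg a = -a := fun _ => rfl
  simp only [d4_eq, mmN_cast, d4N, mulN_eq, ha, hn]
  push_cast
  ring

lemma mm_bil (v w : E8) (i j : Fin 8) :
    mm v w i j = ∑ r, ∑ s, v r * w s * mm (e₈ r) (e₈ s) i j := by
  simp [mm, e₈_apply, mul_sub, Finset.sum_sub_distrib]

lemma d4_bil (v w c d : E8) (i j k l : Fin 8) :
    d4 i j k l v w c d = ∑ r, ∑ s, v r * w s * d4 i j k l (e₈ r) (e₈ s) c d := by
  simp only [d4_eq]
  simp only [mm_bil v w, Finset.sum_mul, ← Finset.sum_add_distrib, ← Finset.sum_sub_distrib]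
  refine Finset.sum_congr rfl fun r _ => Finset.sum_congr rfl fun s _ => ?_
  ring

lemma inner_e₈ (v : E8) (i : Fin 8) : ⟪v, e₈ i⟫ = v i := by
  simp [PiLp.inner_apply, e₈_apply]

lemma wedge_coord (p q : Fin 8) (hpq : p < q) (v w : E8) :
    wedge26 (fun a b => a p * b q - a q * b p) (sixForm v w) e₈ = Phi v w (e₈ p) (e₈ q) := by
  rw [wedge_eq]
  simp only [inner_e₈, Phi_comb, comb_mul]
  rw [comb_altSum]
  simp only [altSum_d4, ← comb_mul]
  rw [← mul_assoc]
  norm_num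
  simp only [d4_bil v w, d4Z_cast, ← comb_sum, ← comb_mul, ← comb_cast]
  simp only [eps_table p q _ _ hpq]

lemma vol8_e₈ : vol8 e₈ = 1 := by
  have : (Matrix.of fun i j : Fin 8 => e₈ i j) = 1 := by
    ext i j
    simp [e₈_apply, Matrix.one_apply, eq_comm]
  simp [vol8, this]

lemma innerF2_coord (p q : Fin 8) (hpq : p < q) (β : E8 → E8 → ℝ) :
    innerF2 (fun a b => a p * b q - a q * b p) β = β (e₈ p) (e₈ q) := by
  simp only [innerF2]
  rw [Finset.sum_eq_single p, Finset.sum_eq_single q]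
  · simp [hpq, e₈_apply, hpq.ne, hpq.ne']
  · intro j _ hj
    simp [e₈_apply, hj.symm, hpq.ne']
  · simp
  · intro i _ hi
    refine Finset.sum_eq_zero fun j _ => ?_
    split_ifs with h
    · have : ¬ (q = i ∧ p = j) := by rintro ⟨rfl, rfl⟩; exact absurd h (not_lt.mpr hpq.le)
      by_cases h1 : q = i
      · have h2 : ¬ p = j := fun h2 => this ⟨h1, h2⟩
        simp [e₈_apply, hi.symm, h2]
      · simp [e₈_apply, hi.symm, h1]
    · rfl
  · simp

lemma innerF2_congr {α α' β β' : E8 → E8 → ℝ}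
    (h : ∀ p q : Fin 8, p < q → α (e₈ p) (e₈ q) = α' (e₈ p) (e₈ q))
    (h' : ∀ p q : Fin 8, p < q → β (e₈ p) (e₈ q) = β' (e₈ p) (e₈ q)) :
    innerF2 α β = innerF2 α' β' := by
  refine Finset.sum_congr rfl fun p _ => Finset.sum_congr rfl fun q _ => ?_
  split_ifs with hpq
  · rw [h p q hpq, h' p q hpq]
  · rfl

lemma innerF2_comm (α β : E8 → E8 → ℝ) : innerF2 α β = innerF2 β α := by
  refine Finset.sum_congr rfl fun p _ => Finset.sum_congr rfl fun q _ => ?_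
  split_ifs
  · ring
  · rfl

lemma innerF2_lin (c₁ c₂ c₃ c₄ : ℝ) (α₁ α₂ α₃ α₄ β : E8 → E8 → ℝ) :
    innerF2 (fun a b => c₁ * α₁ a b + c₂ * α₂ a b + c₃ * α₃ a b + c₄ * α₄ a b) β =
      c₁ * innerF2 α₁ β + c₂ * innerF2 α₂ β + c₃ * innerF2 α₃ β + c₄ * innerF2 α₄ β := by
  simp only [innerF2, Finset.mul_sum, ← Finset.sum_add_distrib]
  refine Finset.sum_congr rfl fun p _ => Finset.sum_congr rfl fun q _ => ?_
  split_ifs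
  · ring
  · ring

lemma innerF2_quad (c₁ c₂ c₃ c₄ : ℝ) (α₁ α₂ α₃ α₄ : E8 → E8 → ℝ) :
    innerF2 (fun a b => c₁ * α₁ a b + c₂ * α₂ a b + c₃ * α₃ a b + c₄ * α₄ a b)
      (fun a b => c₁ * α₁ a b + c₂ * α₂ a b + c₃ * α₃ a b + c₄ * α₄ a b) =
      c₁ ^ 2 * innerF2 α₁ α₁ + c₂ ^ 2 * innerF2 α₂ α₂ + c₃ ^ 2 * innerF2 α₃ α₃
      + c₄ ^ 2 * innerF2 α₄ α₄ + 2 * c₁ * c₂ * innerF2 α₁ α₂ + 2 * c₁ * c₃ * innerF2 α₁ α₃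
      + 2 * c₁ * c₄ * innerF2 α₁ α₄ + 2 * c₂ * c₃ * innerF2 α₂ α₃
      + 2 * c₃ * c₄ * innerF2 α₃ α₄ + 2 * c₂ * c₄ * innerF2 α₄ α₂ := by
  simp only [innerF2, Finset.mul_sum, ← Finset.sum_add_distrib]
  refine Finset.sum_congr rfl fun p _ => Finset.sum_congr rfl fun q _ => ?_
  split_ifs
  · ring
  · ring

lemma keyB (z w : E8) (y : E8) :
    ∑ i, Phi (e₈ i) y z w ^ 2 = 
    ⟪y,y⟫ * (⟪z,z⟫ * ⟪w,w⟫ - ⟪z,w⟫^2) - ⟪y,z⟫ * (⟪y,z⟫ * ⟪w,w⟫ - ⟪z,w⟫ * ⟪y,w⟫)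
    + ⟪y,w⟫ * (⟪y,z⟫ * ⟪z,w⟫ - ⟪z,z⟫*⟪y,w⟫)  := by
  simp only [Fin.sum_univ_eight, Phi, d4_eq, inner_eq]
  simp [mm, e₈_apply]
  ring

/-- The 2-form `v♭ ∧ w♭`. -/
def wed (v w : E8) (a b : E8) : ℝ := ⟪v, a⟫ * ⟪w, b⟫ - ⟪v, b⟫ * ⟪w, a⟫

lemma inner_wed (a b c d : E8) :
    innerF2 (wed a b) (wed c d) = ⟪a,c⟫ * ⟪b,d⟫ - ⟪a,d⟫ * ⟪b,c⟫ := by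
  simp only [innerF2, Fin.sum_univ_eight, wed, inner_e₈]
  simp [inner_eq]
  ring

lemma inner_wed_Phi (a b c d : E8) : innerF2 (wed a b) (Phi c d) = Phi c d a b := by
  simp only [innerF2, Fin.sum_univ_eight, wed, inner_e₈, Phi, d4_eq]
  simp [mm, e₈_apply]
  ring

lemma keyA (a b c d : E8) :
    innerF2 (Phi a b) (Phi c d) = 3 * (⟪a,c⟫ * ⟪b,d⟫ - ⟪a,d⟫ * ⟪b,c⟫) - 2 * Phi a b c d := by
  rw [← inner_wed]
  simp only [innerF2, Fin.sum_univ_eight, wed, inner_e₈, Phi, d4_eq]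
  simp [mm, e₈_apply]
  ring

lemma Phi_pair (a b c d : E8) : Phi c d a b = Phi a b c d := by
  simp only [Phi, d4_eq]; ring

lemma Phi_swap (a b c d : E8) : Phi b a c d = -Phi a b c d := by
  simp only [Phi, d4_eq, mm]; ring

lemma Phi_rot (x a b c : E8) : Phi x b c a = Phi x a b c := by
  simp only [Phi, d4_eq, mm]; ring

lemma Phi_self (a c d : E8) : Phi a a c d = 0 := by
  simp only [Phi, d4_eq, mm]; ring

lemma Phi_self' (a c d : E8) : Phi a c d a = 0 := by
  simp only [Phi, d4_eq, mm]; ring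

lemma Phi_add (x a b c d : E8) : Phi x (a + b) c d = Phi x a c d + Phi x b c d := by
  simp only [Phi, d4_eq, mm, PiLp.add_apply]; ring

/-- Polarised Gram determinant of order three. -/
lemma keyB_polar (x y z w : E8) :
    ∑ i, Phi (e₈ i) y z w * Phi (e₈ i) x z w =
    ⟪x,y⟫ * (⟪z,z⟫ * ⟪w,w⟫ - ⟪z,w⟫^2) - ⟪x,z⟫ * (⟪y,z⟫ * ⟪w,w⟫ - ⟪z,w⟫ * ⟪y,w⟫)
    + ⟪x,w⟫ * (⟪y,z⟫ * ⟪z,w⟫ - ⟪z,z⟫*⟪y,w⟫) := by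
  have h1 := keyB z w (y + x)
  have h2 := keyB z w y
  have h3 := keyB z w x
  have h4 : ∑ i, Phi (e₈ i) (y + x) z w ^ 2 = ∑ i, Phi (e₈ i) y z w ^ 2
      + ∑ i, Phi (e₈ i) x z w ^ 2 + 2 * ∑ i, Phi (e₈ i) y z w * Phi (e₈ i) x z w := by
    rw [Finset.mul_sum, ← Finset.sum_add_distrib, ← Finset.sum_add_distrib]
    exact Finset.sum_congr rfl fun i _ => by rw [Phi_add]; ring
  rw [h4, h2, h3] at h1
  simp only [inner_add_left, inner_add_right, real_inner_comm x y] at h1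
  linear_combination h1 / 2

/-- Harvey–Lawson's identity for the Cayley calibration:
`Φ₀(x,y,z,w)² + ‖τ(x,y,z,w)‖² = |x∧y∧z∧w|²`, where
`τ(a,b,c,d) = −a×P(b,c,d) + ⟨a,b⟩(c×d) + ⟨a,c⟩(d×b) + ⟨a,d⟩(b×c)`,
`P` is the triple cross product (`⟨x, P(y,z,w)⟩ = Φ₀(x,y,z,w)`),
`v × w = ½(v♭∧w♭ − *(v♭∧w♭∧Φ₀))` is the 2-form-valued cross product, the Hodge star
`*β` of a 6-form `β` being the unique 2-form with `α ∧ β = ⟨α, *β⟩ vol` for every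
2-form `α`, and `‖·‖` is the norm of 2-forms on ℝ⁸. -/
theorem cayley_harvey_lawson
    (P : E8 → E8 → E8 → E8)
    (hP : ∀ x y z w : E8, ⟪x, P y z w⟫ = Phi x y z w)
    (star : ((Fin 6 → E8) → ℝ) → (E8 → E8 → ℝ))
    (hstar2 : ∀ v w : E8, IsForm2 (star (sixForm v w)))
    (hstar : ∀ v w : E8, ∀ α : E8 → E8 → ℝ, IsForm2 α →
      ∀ x : Fin 8 → E8,
        wedge26 α (sixForm v w) x = innerF2 α (star (sixForm v w)) * vol8 x)
    (cross : E8 → E8 → E8 → E8 → ℝ)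
    (hcross : ∀ v w a b : E8,
      cross v w a b =
        (1 / 2 : ℝ) * ((⟪v, a⟫ * ⟪w, b⟫ - ⟪v, b⟫ * ⟪w, a⟫) - star (sixForm v w) a b))
    (tau : E8 → E8 → E8 → E8 → E8 → E8 → ℝ)
    (htau : ∀ a b c d p q : E8,
      tau a b c d p q =
        -(cross a (P b c d) p q) + ⟪a, b⟫ * cross c d p q
          + ⟪a, c⟫ * cross d b p q + ⟪a, d⟫ * cross b c p q) :
    ∀ x y z w : E8,
      Phi x y z w ^ 2 + innerF2 (tau x y z w) (tau x y z w) = gram4 x y z w := by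
  have hS : ∀ (v w : E8) (p q : Fin 8), p < q →
      star (sixForm v w) (e₈ p) (e₈ q) = Phi v w (e₈ p) (e₈ q) := by
    intro v w p q hpq
    have h := hstar v w (fun a b => a p * b q - a q * b p)
      ⟨fun a b => by ring, fun a a' b => by simp only [PiLp.add_apply]; ring,
        fun r a b => by simp only [PiLp.smul_apply, smul_eq_mul]; ring⟩ e₈
    rw [wedge_coord p q hpq, innerF2_coord p q hpq, vol8_e₈, mul_one] at h
    exact h.symm
  have hC : ∀ a b c d : E8, innerF2 (cross a b) (cross c d) =
      ⟪a, c⟫ * ⟪b, d⟫ - ⟪a, d⟫ * ⟪b, c⟫ - Phi a b c d := by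
    intro a b c d
    let F : E8 → E8 → E8 → E8 → ℝ := fun a b u v =>
      (1 / 2 : ℝ) * wed a b u v + (-1 / 2 : ℝ) * Phi a b u v
          + 0 * wed a b u v + 0 * wed a b u v
    have hform : ∀ (a b : E8) (p q : Fin 8), p < q → cross a b (e₈ p) (e₈ q) =
        F a b (e₈ p) (e₈ q) := by
      intro a b p q hpq
      simp only [F]
      rw [hcross, hS a b p q hpq]
      simp only [wed]
      ring
    rw [innerF2_congr (hform a b) (hform c d)]
    simp only [F]
    rw [innerF2_lin,
      innerF2_comm (wed a b), innerF2_comm (Phi a b), innerF2_lin, innerF2_lin,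
      innerF2_comm (wed c d) (wed a b), innerF2_comm (Phi c d) (wed a b),
      innerF2_comm (Phi c d) (Phi a b), inner_wed, inner_wed_Phi, inner_wed_Phi, keyA,
      Phi_pair a b c d]
    ring
  have hPi : ∀ (y z w : E8) (i : Fin 8), (P y z w) i = Phi (e₈ i) y z w := by
    intro y z w i
    rw [← hP, real_inner_comm, inner_e₈]
  have hPP : ∀ x y z w : E8, ⟪P y z w, P x z w⟫ = 
      ⟪x,y⟫ * (⟪z,z⟫ * ⟪w,w⟫ - ⟪z,w⟫^2) - ⟪x,z⟫ * (⟪y,z⟫ * ⟪w,w⟫ - ⟪z,w⟫ * ⟪y,w⟫)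
        + ⟪x,w⟫ * (⟪y,z⟫ * ⟪z,w⟫ - ⟪z,z⟫*⟪y,w⟫) := by
    intro x y z w
    rw [← keyB_polar, inner_eq, Fin.sum_univ_eight]
    simp only [hPi]
  have hrot : ∀ y z w : E8, P z w y = P y z w := by
    intro y z w
    refine ext_inner_left ℝ fun x => ?_
    rw [hP, hP, Phi_rot]
  have hxP : ∀ x y z w : E8, innerF2 (cross x (P y z w)) (cross z w) =
      ⟪x,y⟫ * (⟪z,z⟫ * ⟪w,w⟫ - ⟪z,w⟫^2) - ⟪x,z⟫ * (⟪y,z⟫ * ⟪w,w⟫ - ⟪z,w⟫ * ⟪y,w⟫)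
        + ⟪x,w⟫ * (⟪y,z⟫ * ⟪z,w⟫ - ⟪z,z⟫*⟪y,w⟫) := by
    intro x y z w
    have h1 : ⟪P y z w, w⟫ = 0 := by rw [real_inner_comm, hP, Phi_self']
    have h2 : ⟪P y z w, z⟫ = 0 := by rw [real_inner_comm, ← hrot, hP, Phi_self]
    rw [hC, h1, h2, Phi_swap, ← hP, hPP]
    ring
  intro x y z w
  have ht : tau x y z w = fun p q => (-1) * cross x (P y z w) p q + ⟪x, y⟫ * cross z w p q
      + ⟪x, z⟫ * cross w y p q + ⟪x, w⟫ * cross y z p q := by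
    funext p q
    rw [htau]; ring
  have t1 := hxP x y z w
  have t2 := hxP x z w y
  have t3 := hxP x w y z
  rw [hrot y z w] at t2
  rw [← hrot w y z] at t3
  have t0 : innerF2 (cross x (P y z w)) (cross x (P y z w)) =
      ⟪x, x⟫ * ⟪P y z w, P y z w⟫ - Phi x y z w ^ 2 := by
    have h0 : Phi x (P y z w) x (P y z w) = 0 := by
      simp only [Phi, d4_eq, mm]; ring
    rw [hC, h0, real_inner_comm x (P y z w), hP x y z w]
    ring
  rw [hPP] at t0
  have u1 : ∀ a b c : E8, innerF2 (cross a b) (cross b c) =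
      ⟪a, b⟫ * ⟪b, c⟫ - ⟪a, c⟫ * ⟪b, b⟫ := by
    intro a b c
    have h0 : Phi a b b c = 0 := by simp only [Phi, d4_eq, mm]; ring
    rw [hC, h0]; ring
  have u2 : ∀ a b : E8, innerF2 (cross a b) (cross a b) =
      ⟪a, a⟫ * ⟪b, b⟫ - ⟪a, b⟫ ^ 2 := by
    intro a b
    have h0 : Phi a b a b = 0 := by simp only [Phi, d4_eq, mm]; ring
    rw [hC, h0, real_inner_comm a b]; ring
  have hgram : gram4 x y z w = ⟪x, x⟫ * (⟪y,y⟫ * (⟪z,z⟫ * ⟪w,w⟫ - ⟪z,w⟫^2)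
      - ⟪y,z⟫ * (⟪y,z⟫ * ⟪w,w⟫ - ⟪z,w⟫ * ⟪y,w⟫) + ⟪y,w⟫ * (⟪y,z⟫ * ⟪z,w⟫ - ⟪z,z⟫*⟪y,w⟫))
      - ⟪x, y⟫ * (⟪x,y⟫ * (⟪z,z⟫ * ⟪w,w⟫ - ⟪z,w⟫^2)
      - ⟪x,z⟫ * (⟪y,z⟫ * ⟪w,w⟫ - ⟪z,w⟫ * ⟪y,w⟫) + ⟪x,w⟫ * (⟪y,z⟫ * ⟪z,w⟫ - ⟪z,z⟫*⟪y,w⟫))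
      + ⟪x, z⟫ * (⟪x,y⟫ * (⟪y,z⟫ * ⟪w,w⟫ - ⟪y,w⟫ * ⟪z,w⟫)
      - ⟪x,z⟫ * (⟪y,y⟫ * ⟪w,w⟫ - ⟪y,w⟫ ^ 2) + ⟪x,w⟫ * (⟪y,y⟫ * ⟪z,w⟫ - ⟪y,z⟫*⟪y,w⟫))
      - ⟪x, w⟫ * (⟪x,y⟫ * (⟪y,z⟫ * ⟪z,w⟫ - ⟪y,w⟫ * ⟪z,z⟫)
      - ⟪x,z⟫ * (⟪y,y⟫ * ⟪z,w⟫ - ⟪y,w⟫ * ⟪y,z⟫) + ⟪x,w⟫ * (⟪y,y⟫ * ⟪z,z⟫ - ⟪y,z⟫^2)) := by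
    simp only [gram4, real_inner_comm x y, real_inner_comm x z, real_inner_comm x w,
      real_inner_comm y z, real_inner_comm y w, real_inner_comm z w]
    generalize ⟪x, x⟫ = xx, ⟪x, y⟫ = xy, ⟪x, z⟫ = xz, ⟪x, w⟫ = xw, ⟪y, y⟫ = yy, ⟪y, z⟫ = yz,
      ⟪y, w⟫ = yw, ⟪z, z⟫ = zz, ⟪z, w⟫ = zw, ⟪w, w⟫ = ww
    simp only [Matrix.det_succ_row_zero, Fin.sum_univ_succ]
    simp [Fin.succAbove]
    ring
  rw [ht, innerF2_quad, hgram, t0, t1, t2, t3, u1, u1, u1, u2, u2, u2]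
  simp only [real_inner_comm x y, real_inner_comm x z, real_inner_comm x w,
      real_inner_comm y z, real_inner_comm y w, real_inner_comm z w]
  ring
end
end

section
/- The Cayley 4-form Φ₀ is a calibration on ℝ⁸: for all vectors x, y, z, w in ℝ⁸, Φ₀(x,y,z,w)² ≤ |x∧y∧z∧w|²; in particular |Φ₀(x,y,z,w)| ≤ 1 whenever x, y, z, w are orthonormal. -/
noncomputable section
open scoped RealInnerProductSpace

/-- one component of the triple cross product -/
def d3 (i j k : Fin 8) (x y z : E8) : ℝ :=
  (x i * y j - x j * y i) * z k - (x i * y k - x k * y i) * z j + (x j * y k - x k * y j) * z i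

def U0 (x y z : E8) : ℝ :=
  - d3 1 2 3 x y z - d3 1 4 5 x y z + d3 1 6 7 x y z - d3 2 4 6 x y z - d3 2 5 7 x y z - d3 3 4 7 x y z + d3 3 5 6 x y z

def U1 (x y z : E8) : ℝ :=
  d3 0 2 3 x y z + d3 0 4 5 x y z - d3 0 6 7 x y z + d3 2 4 7 x y z - d3 2 5 6 x y z - d3 3 4 6 x y z - d3 3 5 7 x y z

def U2 (x y z : E8) : ℝ :=
  - d3 0 1 3 x y z + d3 0 4 6 x y z + d3 0 5 7 x y z - d3 1 4 7 x y z + d3 1 5 6 x y z + d3 3 4 5 x y z - d3 3 6 7 x y z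

def U3 (x y z : E8) : ℝ :=
  d3 0 1 2 x y z + d3 0 4 7 x y z - d3 0 5 6 x y z + d3 1 4 6 x y z + d3 1 5 7 x y z - d3 2 4 5 x y z + d3 2 6 7 x y z

def U4 (x y z : E8) : ℝ :=
  - d3 0 1 5 x y z - d3 0 2 6 x y z - d3 0 3 7 x y z + d3 1 2 7 x y z - d3 1 3 6 x y z + d3 2 3 5 x y z - d3 5 6 7 x y z

def U5 (x y z : E8) : ℝ :=
  d3 0 1 4 x y z - d3 0 2 7 x y z + d3 0 3 6 x y z - d3 1 2 6 x y z - d3 1 3 7 x y z - d3 2 3 4 x y z + d3 4 6 7 x y z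

def U6 (x y z : E8) : ℝ :=
  d3 0 1 7 x y z + d3 0 2 4 x y z - d3 0 3 5 x y z + d3 1 2 5 x y z + d3 1 3 4 x y z - d3 2 3 7 x y z - d3 4 5 7 x y z

def U7 (x y z : E8) : ℝ :=
  - d3 0 1 6 x y z + d3 0 2 5 x y z + d3 0 3 4 x y z - d3 1 2 4 x y z + d3 1 3 5 x y z + d3 2 3 6 x y z + d3 4 5 6 x y z

/-- The triple cross product dual to `Phi`. -/
def X3 (x y z : E8) : E8 :=
  !₂[U0 x y z, U1 x y z, U2 x y z, U3 x y z, U4 x y z, U5 x y z, U6 x y z, U7 x y z]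

theorem inner8 (a b : E8) : ⟪a, b⟫ = a 0 * b 0 + a 1 * b 1 + a 2 * b 2 + a 3 * b 3 + a 4 * b 4
    + a 5 * b 5 + a 6 * b 6 + a 7 * b 7 := by
  simp only [PiLp.inner_apply, Fin.sum_univ_eight, RCLike.inner_apply, conj_trivial]
  ring

theorem inner_X3 (x y z w : E8) : ⟪X3 x y z, w⟫ = U0 x y z * w 0 + U1 x y z * w 1 + U2 x y z * w 2
    + U3 x y z * w 3 + U4 x y z * w 4 + U5 x y z * w 5 + U6 x y z * w 6 + U7 x y z * w 7 := by
  rw [inner8]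
  rfl

theorem d4_expand (i j k l : Fin 8) (x y z w : E8) : d4 i j k l x y z w =
    d3 i j k x y z * w l - d3 i j l x y z * w k + d3 i k l x y z * w j - d3 j k l x y z * w i := by
  simp [d4, d3, Matrix.det_succ_row_zero, Fin.sum_univ_succ, Fin.succAbove]
  ring

theorem Phi_eq (x y z w : E8) : Phi x y z w = ⟪X3 x y z, w⟫ := by
  rw [inner_X3]
  simp only [Phi, d4_expand, U0, U1, U2, U3, U4, U5, U6, U7]
  ring

theorem X3_x (x y z : E8) : ⟪X3 x y z, x⟫ = 0 := by
  rw [inner_X3]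
  simp only [U0, U1, U2, U3, U4, U5, U6, U7, d3]
  ring

theorem X3_y (x y z : E8) : ⟪X3 x y z, y⟫ = 0 := by
  rw [inner_X3]
  simp only [U0, U1, U2, U3, U4, U5, U6, U7, d3]
  ring

theorem X3_z (x y z : E8) : ⟪X3 x y z, z⟫ = 0 := by
  rw [inner_X3]
  simp only [U0, U1, U2, U3, U4, U5, U6, U7, d3]
  ring

/-- The Gram determinant of three vectors. -/
def gram3 (x y z : E8) : ℝ :=
  ⟪x, x⟫ * (⟪y, y⟫ * ⟪z, z⟫ - ⟪y, z⟫ ^ 2) - ⟪x, y⟫ * (⟪x, y⟫ * ⟪z, z⟫ - ⟪y, z⟫ * ⟪x, z⟫)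
    + ⟪x, z⟫ * (⟪x, y⟫ * ⟪y, z⟫ - ⟪y, y⟫ * ⟪x, z⟫)

set_option maxHeartbeats 0 in
theorem X3_norm (x y z : E8) : ⟪X3 x y z, X3 x y z⟫ = gram3 x y z := by
  have h : ⟪X3 x y z, X3 x y z⟫ = U0 x y z ^ 2 + U1 x y z ^ 2 + U2 x y z ^ 2 + U3 x y z ^ 2
      + U4 x y z ^ 2 + U5 x y z ^ 2 + U6 x y z ^ 2 + U7 x y z ^ 2 := by
    rw [inner_X3]
    simp only [X3, PiLp.toLp_apply, Matrix.cons_val]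
    ring
  rw [h]
  simp only [gram3, inner8, U0, U1, U2, U3, U4, U5, U6, U7, d3]
  generalize x 0 = x0
  generalize x 1 = x1
  generalize x 2 = x2
  generalize x 3 = x3
  generalize x 4 = x4
  generalize x 5 = x5
  generalize x 6 = x6
  generalize x 7 = x7
  generalize y 0 = y0
  generalize y 1 = y1
  generalize y 2 = y2
  generalize y 3 = y3
  generalize y 4 = y4
  generalize y 5 = y5
  generalize y 6 = y6
  generalize y 7 = y7
  generalize z 0 = z0
  generalize z 1 = z1
  generalize z 2 = z2
  generalize z 3 = z3
  generalize z 4 = z4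
  generalize z 5 = z5
  generalize z 6 = z6
  generalize z 7 = z7
  ring

theorem gram4_expand (x y z w : E8) : gram4 x y z w =
    gram3 x y z * ⟪w, w⟫
    - ((⟪y, y⟫ * ⟪z, z⟫ - ⟪y, z⟫ ^ 2) * ⟪x, w⟫ + (⟪x, z⟫ * ⟪y, z⟫ - ⟪x, y⟫ * ⟪z, z⟫) * ⟪y, w⟫
      + (⟪x, y⟫ * ⟪y, z⟫ - ⟪x, z⟫ * ⟪y, y⟫) * ⟪z, w⟫) * ⟪x, w⟫
    - ((⟪x, z⟫ * ⟪y, z⟫ - ⟪x, y⟫ * ⟪z, z⟫) * ⟪x, w⟫ + (⟪x, x⟫ * ⟪z, z⟫ - ⟪x, z⟫ ^ 2) * ⟪y, w⟫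
      + (⟪x, y⟫ * ⟪x, z⟫ - ⟪x, x⟫ * ⟪y, z⟫) * ⟪z, w⟫) * ⟪y, w⟫
    - ((⟪x, y⟫ * ⟪y, z⟫ - ⟪x, z⟫ * ⟪y, y⟫) * ⟪x, w⟫ + (⟪x, y⟫ * ⟪x, z⟫ - ⟪x, x⟫ * ⟪y, z⟫) * ⟪y, w⟫
      + (⟪x, x⟫ * ⟪y, y⟫ - ⟪x, y⟫ ^ 2) * ⟪z, w⟫) * ⟪z, w⟫ := by
  unfold gram4 gram3
  rw [real_inner_comm x y, real_inner_comm x z, real_inner_comm x w, real_inner_comm y z,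
    real_inner_comm y w, real_inner_comm z w]
  simp [Matrix.det_succ_row_zero, Fin.sum_univ_succ, Fin.succAbove]
  ring

theorem gram4_nonneg (x y z w : E8) : 0 ≤ gram4 x y z w := by
  have h := (Matrix.posSemidef_gram ℝ ![x, y, z, w]).det_nonneg
  have e : gram4 x y z w = (Matrix.gram ℝ ![x, y, z, w]).det := by
    unfold gram4
    congr 1
    ext i j
    fin_cases i <;> fin_cases j <;> rfl
  rw [e]
  exact h

theorem Phi_sq_le (x y z w : E8) : Phi x y z w ^ 2 ≤ gram4 x y z w := by
  rw [Phi_eq]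
  by_cases hG : gram3 x y z = 0
  · have h0 : X3 x y z = 0 := by
      rw [← inner_self_eq_zero (𝕜 := ℝ), X3_norm, hG]
    rw [h0, inner_zero_left]
    simpa using gram4_nonneg x y z w
  · obtain ⟨a, ha⟩ : ∃ a, a = (⟪y, y⟫ * ⟪z, z⟫ - ⟪y, z⟫ ^ 2) * ⟪x, w⟫
      + (⟪x, z⟫ * ⟪y, z⟫ - ⟪x, y⟫ * ⟪z, z⟫) * ⟪y, w⟫
      + (⟪x, y⟫ * ⟪y, z⟫ - ⟪x, z⟫ * ⟪y, y⟫) * ⟪z, w⟫ := ⟨_, rfl⟩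
    obtain ⟨b, hb⟩ : ∃ b, b = (⟪x, z⟫ * ⟪y, z⟫ - ⟪x, y⟫ * ⟪z, z⟫) * ⟪x, w⟫
      + (⟪x, x⟫ * ⟪z, z⟫ - ⟪x, z⟫ ^ 2) * ⟪y, w⟫
      + (⟪x, y⟫ * ⟪x, z⟫ - ⟪x, x⟫ * ⟪y, z⟫) * ⟪z, w⟫ := ⟨_, rfl⟩
    obtain ⟨c, hc⟩ : ∃ c, c = (⟪x, y⟫ * ⟪y, z⟫ - ⟪x, z⟫ * ⟪y, y⟫) * ⟪x, w⟫
      + (⟪x, y⟫ * ⟪x, z⟫ - ⟪x, x⟫ * ⟪y, z⟫) * ⟪y, w⟫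
      + (⟪x, x⟫ * ⟪y, y⟫ - ⟪x, y⟫ ^ 2) * ⟪z, w⟫ := ⟨_, rfl⟩
    have hg4 := gram4_expand x y z w
    rw [← ha, ← hb, ← hc] at hg4
    have hcs := real_inner_mul_inner_self_le (X3 x y z)
      (gram3 x y z • w - a • x - b • y - c • z)
    have h1 : ⟪X3 x y z, gram3 x y z • w - a • x - b • y - c • z⟫
        = gram3 x y z * ⟪X3 x y z, w⟫ := by
      simp only [inner_sub_right, real_inner_smul_right, X3_x, X3_y, X3_z]
      ring
    have h2 : ⟪gram3 x y z • w - a • x - b • y - c • z, gram3 x y z • w - a • x - b • y - c • z⟫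
        = gram3 x y z * gram4 x y z w := by
      rw [hg4]
      simp only [inner_sub_right, inner_sub_left, real_inner_smul_right, real_inner_smul_left]
      rw [real_inner_comm x y, real_inner_comm x z, real_inner_comm x w, real_inner_comm y z,
        real_inner_comm y w, real_inner_comm z w]
      rw [ha, hb, hc]
      unfold gram3
      ring
    rw [h1, h2, X3_norm] at hcs
    have hpos : 0 < gram3 x y z ^ 2 := by positivity
    refine le_of_mul_le_mul_left ?_ hpos
    linarith [hcs]

/-- the Cayley 4-form is a calibration on ℝ⁸:
`Φ₀(x,y,z,w)² ≤ |x∧y∧z∧w|²` for all `x,y,z,w`, and `|Φ₀| ≤ 1` on orthonormal quadruples. -/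
theorem cayley_is_calibration :
    (∀ x y z w : E8, Phi x y z w ^ 2 ≤ gram4 x y z w) ∧
    (∀ x y z w : E8, Orthonormal ℝ ![x, y, z, w] → |Phi x y z w| ≤ 1) := by
  refine ⟨Phi_sq_le, fun x y z w h => ?_⟩
  have h1 : gram4 x y z w = 1 := by
    have e : gram4 x y z w = (Matrix.gram ℝ ![x, y, z, w]).det := by
      unfold gram4
      congr 1
      ext i j
      fin_cases i <;> fin_cases j <;> rfl
    have e2 : Matrix.gram ℝ ![x, y, z, w] = 1 := by
      ext i j
      rw [Matrix.gram_apply, orthonormal_iff_ite.mp h i j, Matrix.one_apply]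
    rw [e, e2, Matrix.det_one]
  rw [← sq_le_one_iff_abs_le_one, ← h1]
  exact Phi_sq_le x y z w
end
end
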